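/- arXiv:0907.1129 — 2 statements merged into one kernel-verified Lean document; each statement's English description precedes it below -/
import Mathlib

section
/- Let λ : A → A be a unital *-homomorphism and U, V unitaries of A with λ(s_{e_i}) = U s_{e_i} and λ(s_{f_j}) = V s_{f_j} for all i, j, and set W := U λ_{ε1}(V). If W ∈ 𝔉, then λ(𝔉) ⊆ 𝔉. -/
open scoped ComplexOrder

noncomputable section

variable {A : Type*} [CStarAlgebra A]

/-- The map `λ_ε` associated to a family `s`: `X ↦ ∑ i, s i * X * (s i)^*`.
With `s = s_e` this is `λ_{ε₁}`; with `s = s_f` this is `λ_{ε₂}`. -/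
def lamE {m : ℕ} (s : Fin m → A) (X : A) : A := ∑ i, s i * X * star (s i)

/-- The word `s_{a,b} = s_{e_{a_1}}⋯s_{e_{a_k}} s_{f_{b_1}}⋯s_{f_{b_l}}` of degree `(k,l)`. -/
def sWord {m n : ℕ} (se : Fin m → A) (sf : Fin n → A)
    {k l : ℕ} (a : Fin k → Fin m) (b : Fin l → Fin n) : A :=
  (List.ofFn fun t => se (a t)).prod * (List.ofFn fun t => sf (b t)).prod

/-- The UHF core `𝔉`: closed linear span of `s_{a,b} s_{a',b'}^*` over pairs of words of
equal degree. -/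
def FF {m n : ℕ} (se : Fin m → A) (sf : Fin n → A) : Submodule ℂ A :=
  (Submodule.span ℂ {x : A | ∃ (k l : ℕ) (a a' : Fin k → Fin m) (b b' : Fin l → Fin n),
    x = sWord se sf a b * star (sWord se sf a' b')}).topologicalClosure

/-- The canonical masa `𝔇`: closed linear span of `s_{a,b} s_{a,b}^*`. -/
def DD {m n : ℕ} (se : Fin m → A) (sf : Fin n → A) : Submodule ℂ A :=
  (Submodule.span ℂ {x : A | ∃ (k l : ℕ) (a : Fin k → Fin m) (b : Fin l → Fin n),
    x = sWord se sf a b * star (sWord se sf a b)}).topologicalClosure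

section OrderedMonoid

variable {M : Type*} [Monoid M] [Preorder M] [MulLeftMono M] [MulRightMono M] {a b c d : M}

theorem one_le_pow_mul_pow_of_one_le_mul (h : 1 ≤ a * b) (k : ℕ) : 1 ≤ a ^ k * b ^ k := by
  induction k with
  | zero => simp
  | succ k ih =>
    calc (1 : M) ≤ a ^ k * b ^ k := ih
      _ = a ^ k * 1 * b ^ k := by rw [mul_one]
      _ ≤ a ^ k * (a * b) * b ^ k := by gcongr
      _ = a ^ (k + 1) * b ^ (k + 1) := by simp only [pow_succ a, pow_succ' b, mul_assoc]

theorem pow_mul_pow_le_one_of_mul_le_one (h : b * a ≤ 1) (k : ℕ) : b ^ k * a ^ k ≤ 1 := by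
  induction k with
  | zero => simp
  | succ k ih =>
    calc b ^ (k + 1) * a ^ (k + 1) = b ^ k * (b * a) * a ^ k := by
          simp only [pow_succ b, pow_succ' a, mul_assoc]
      _ ≤ b ^ k * 1 * a ^ k := by gcongr
      _ ≤ 1 := by rwa [mul_one]

theorem monotone_pow_mul_pow (h : 1 ≤ a * b) : Monotone fun k : ℕ => a ^ k * b ^ k := by
  refine monotone_nat_of_le_succ fun k => ?_
  calc a ^ k * b ^ k = a ^ k * 1 * b ^ k := by rw [mul_one]
    _ ≤ a ^ k * (a * b) * b ^ k := by gcongr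
    _ = a ^ (k + 1) * b ^ (k + 1) := by simp only [pow_succ a, pow_succ' b, mul_assoc]

theorem pow_mul_pow_mul_self_le (h : b * a ≤ 1) (k : ℕ) :
    a ^ k * b ^ k * (a ^ k * b ^ k) ≤ a ^ k * b ^ k := by
  calc a ^ k * b ^ k * (a ^ k * b ^ k) = a ^ k * (b ^ k * a ^ k) * b ^ k := by
        simp only [mul_assoc]
    _ ≤ a ^ k * 1 * b ^ k := by gcongr; exact pow_mul_pow_le_one_of_mul_le_one h k
    _ = a ^ k * b ^ k := by rw [mul_one]

theorem bidegree_le_diagonal (hac : Commute a c) (hbd : Commute b d)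
    (hab : 1 ≤ a * b) (hcd : 1 ≤ c * d) (k l : ℕ) :
    a ^ k * c ^ l * (d ^ l * b ^ k) ≤ (a * c) ^ (k + l) * (d * b) ^ (k + l) := by
  have h₁ : 1 ≤ a ^ l * (c ^ k * d ^ k) * b ^ l :=
    calc (1 : M) ≤ a ^ l * b ^ l := one_le_pow_mul_pow_of_one_le_mul hab l
      _ = a ^ l * 1 * b ^ l := by rw [mul_one]
      _ ≤ _ := by gcongr; exact one_le_pow_mul_pow_of_one_le_mul hcd k
  have h₂ : a ^ k * c ^ l * (a ^ l * c ^ k) = (a * c) ^ (k + l) := by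
    rw [hac.mul_pow, pow_add a, add_comm k l, pow_add c, mul_assoc, ← mul_assoc (c ^ l),
      ← (hac.pow_pow l l).eq]
    simp only [mul_assoc]
  have h₃ : d ^ k * b ^ l * (d ^ l * b ^ k) = (d * b) ^ (k + l) := by
    rw [hbd.symm.mul_pow, pow_add d, add_comm k l, pow_add b, mul_assoc, ← mul_assoc (b ^ l),
      (hbd.pow_pow l l).eq]
    simp only [mul_assoc]
  calc a ^ k * c ^ l * (d ^ l * b ^ k) = a ^ k * c ^ l * 1 * (d ^ l * b ^ k) := by rw [mul_one]
    _ ≤ a ^ k * c ^ l * (a ^ l * (c ^ k * d ^ k) * b ^ l) * (d ^ l * b ^ k) := by gcongr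
    _ = a ^ k * c ^ l * (a ^ l * c ^ k) * (d ^ k * b ^ l * (d ^ l * b ^ k)) := by
      simp only [mul_assoc]
    _ = _ := by rw [h₂, h₃]

end OrderedMonoid

theorem Submodule.topologicalClosure_mul_le (p q : Submodule ℂ A) :
    p.topologicalClosure * q.topologicalClosure ≤ (p * q).topologicalClosure :=
  Submodule.mul_le.2 fun _ hx _ hy =>
    map_mem_closure₂ continuous_mul hx hy fun _ ha _ hb => Submodule.mul_mem_mul ha hb

open scoped Pointwise

theorem Set.star_pow_eq (s : Set A) (k : ℕ) : star (s ^ k) = star s ^ k := by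
  induction k with
  | zero =>
    ext x
    simp only [pow_zero, Set.mem_star, Set.mem_one, star_eq_iff_star_eq (r := x), star_one, eq_comm]
  | succ k ih => rw [pow_succ, Set.star_mul, ih, pow_succ']

/-- The core as the closed sum of its bidegree `(k, l)` pieces. -/
theorem FF_eq_closure_iSup {m n : ℕ} (se : Fin m → A) (sf : Fin n → A) :
    FF se sf = (⨆ (k : ℕ) (l : ℕ),
      Submodule.span ℂ (Set.range se) ^ k * Submodule.span ℂ (Set.range sf) ^ l *
      (Submodule.span ℂ (star (Set.range sf)) ^ l *
        Submodule.span ℂ (star (Set.range se)) ^ k)).topologicalClosure := by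
  have hpow {r : ℕ} (s : Fin r → A) (k : ℕ) (x : A) :
      x ∈ Set.range s ^ k ↔ ∃ a : Fin k → Fin r, (List.ofFn fun t => s (a t)).prod = x := by
    rw [Set.mem_pow]
    constructor
    · rintro ⟨g, rfl⟩
      choose a ha using fun t => (g t).2
      exact ⟨a, by simp only [ha]⟩
    · rintro ⟨a, rfl⟩
      exact ⟨fun t => ⟨s (a t), a t, rfl⟩, rfl⟩
  have hword (k l : ℕ) (x : A) : x ∈ Set.range se ^ k * Set.range sf ^ l ↔
      ∃ (a : Fin k → Fin m) (b : Fin l → Fin n), sWord se sf a b = x := by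
    simp only [Set.mem_mul, hpow, sWord]
    constructor
    · rintro ⟨_, ⟨a, rfl⟩, _, ⟨b, rfl⟩, rfl⟩
      exact ⟨a, b, rfl⟩
    · rintro ⟨a, b, rfl⟩
      exact ⟨_, ⟨a, rfl⟩, _, ⟨b, rfl⟩, rfl⟩
  simp only [FF, Submodule.span_pow, Submodule.span_mul_span, ← Set.star_pow_eq, ← Set.star_mul,
    ← Submodule.span_iUnion]
  congr 2
  ext x
  simp only [Set.mem_ofPred_eq, Set.mem_iUnion]
  refine exists_congr fun k => exists_congr fun l => ?_
  rw [Set.mem_mul]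
  constructor
  · rintro ⟨a, a', b, b', rfl⟩
    exact ⟨_, (hword k l _).2 ⟨a, b, rfl⟩, _,
      Set.star_mem_star.2 ((hword k l _).2 ⟨a', b', rfl⟩), rfl⟩
  · rintro ⟨y, hy, z, hz, rfl⟩
    obtain ⟨a, b, rfl⟩ := (hword k l y).1 hy
    obtain ⟨a', b', h⟩ := (hword k l (star z)).1 hz
    exact ⟨a, a', b, b', by rw [h, star_star]⟩

theorem star_mem_FF {m n : ℕ} {se : Fin m → A} {sf : Fin n → A} {x : A} (hx : x ∈ FF se sf) :
    star x ∈ FF se sf := by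
  refine map_mem_closure continuous_star hx fun y hy => ?_
  induction hy using Submodule.span_induction with
  | mem y hy =>
    obtain ⟨k, l, a, a', b, b', rfl⟩ := hy
    exact Submodule.subset_span ⟨k, l, a', a, b', b, by simp⟩
  | zero => simp
  | add y z _ _ hy hz => rw [star_add]; exact add_mem hy hz
  | smul c y _ hy => rw [star_smul]; exact Submodule.smul_mem _ _ hy

theorem span_star_mul_span_le_one {r : ℕ} {s : Fin r → A}
    (hs : ∀ i k, star (s i) * s k = if i = k then (1 : A) else 0) :
    Submodule.span ℂ (star (Set.range s)) * Submodule.span ℂ (Set.range s) ≤ 1 := by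
  rw [Submodule.span_mul_span, Submodule.span_le]
  rintro _ ⟨x, ⟨i, hi⟩, _, ⟨k, rfl⟩, rfl⟩
  obtain rfl : star (s i) = x := by rw [hi, star_star]
  simp only [hs, SetLike.mem_coe]
  split_ifs
  · exact Submodule.one_le.1 le_rfl
  · exact zero_mem _

theorem one_le_span_mul_span_star {r : ℕ} {s : Fin r → A} (hs : ∑ i, s i * star (s i) = 1) :
    1 ≤ Submodule.span ℂ (Set.range s) * Submodule.span ℂ (star (Set.range s)) := by
  rw [Submodule.one_le, ← hs]
  exact sum_mem fun i _ => Submodule.mul_mem_mul (Submodule.subset_span ⟨i, rfl⟩)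
    (Submodule.subset_span (Set.star_mem_star.2 ⟨i, rfl⟩))

theorem range_mul_range_comm {m n : ℕ} (θ : Equiv.Perm (Fin m × Fin n))
    {se : Fin m → A} {sf : Fin n → A}
    (h : ∀ i j, se i * sf j = sf (θ (i, j)).2 * se (θ (i, j)).1) :
    Set.range se * Set.range sf = Set.range sf * Set.range se := by
  ext x
  simp only [Set.mem_mul]
  constructor
  · rintro ⟨_, ⟨i, rfl⟩, _, ⟨j, rfl⟩, rfl⟩
    exact ⟨_, ⟨_, rfl⟩, _, ⟨_, rfl⟩, (h i j).symm⟩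
  · rintro ⟨_, ⟨j, rfl⟩, _, ⟨i, rfl⟩, rfl⟩
    refine ⟨_, ⟨(θ.symm (i, j)).1, rfl⟩, _, ⟨(θ.symm (i, j)).2, rfl⟩, ?_⟩
    simp [h]

theorem lamE_mul {r : ℕ} {s : Fin r → A}
    (hs : ∀ i k, star (s i) * s k = if i = k then (1 : A) else 0) (X : A) (i : Fin r) :
    lamE s X * s i = s i * X := by
  simp [lamE, Finset.sum_mul, mul_assoc, hs]

/-- first assertion of Proposition 4.2(i): if `W = U λ_{ε₁}(V) ∈ 𝔉`,
then `λ(𝔉) ⊆ 𝔉`. -/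
theorem stmt9 {m n : ℕ} (hm : 1 ≤ m) (hn : 1 ≤ n) (θ : Equiv.Perm (Fin m × Fin n))
    (se : Fin m → A) (sf : Fin n → A)
    (he : ∀ i k, star (se i) * se k = if i = k then (1:A) else 0)
    (hf : ∀ j l, star (sf j) * sf l = if j = l then (1:A) else 0)
    (hcomm : ∀ i j, se i * sf j = sf (θ (i, j)).2 * se (θ (i, j)).1)
    (hde : ∑ i, se i * star (se i) = 1)
    (hdf : ∑ j, sf j * star (sf j) = 1)
    (lam : A →⋆ₐ[ℂ] A) (U V : A) (hU : U ∈ unitary A) (hV : V ∈ unitary A)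
    (hle : ∀ i, lam (se i) = U * se i) (hlf : ∀ j, lam (sf j) = V * sf j)
    (W : A) (hW : W = U * lamE se V)
    (hWF : W ∈ FF se sf) :
    ∀ x ∈ FF se sf, lam x ∈ FF se sf := by
  set e := Submodule.span ℂ (Set.range se)
  set f := Submodule.span ℂ (Set.range sf)
  set e' := Submodule.span ℂ (star (Set.range se))
  set f' := Submodule.span ℂ (star (Set.range sf))
  have hee : e' * e ≤ 1 := span_star_mul_span_le_one he
  have hff : f' * f ≤ 1 := span_star_mul_span_le_one hf
  have hee' : 1 ≤ e * e' := one_le_span_mul_span_star hde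
  have hff' : 1 ≤ f * f' := one_le_span_mul_span_star hdf
  have hef : Commute e f := by
    rw [commute_iff_eq, Submodule.span_mul_span, Submodule.span_mul_span,
      range_mul_range_comm θ hcomm]
  have hef' : Commute e' f' := by
    rw [commute_iff_eq, Submodule.span_mul_span, Submodule.span_mul_span, ← Set.star_mul,
      ← Set.star_mul, range_mul_range_comm θ hcomm]
  set G := e * f with hG
  set G' := f' * e' with hG'
  have hGG' : 1 ≤ G * G' :=
    calc 1 ≤ e * e' := hee'
      _ = e * 1 * e' := by rw [mul_one]
      _ ≤ e * (f * f') * e' := by gcongr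
      _ = G * G' := by simp only [hG, hG', mul_assoc]
  have hG'G : G' * G ≤ 1 :=
    calc G' * G = f' * (e' * e) * f := by simp only [hG, hG', mul_assoc]
      _ ≤ f' * 1 * f := by gcongr
      _ ≤ 1 := by rwa [mul_one]
  set T : ℕ → Submodule ℂ A := fun k => G ^ k * G' ^ k with hT
  have hTmono : Monotone T := monotone_pow_mul_pow hGG'
  have hFT : FF se sf = (⨆ k, T k).topologicalClosure := by
    rw [FF_eq_closure_iSup]
    congr 1
    refine le_antisymm (iSup₂_le fun k l => ?_) (iSup_le fun k => ?_)
    · exact (bidegree_le_diagonal hef hef' hee' hff' k l).trans (le_iSup T (k + l))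
    · refine le_trans (le_of_eq ?_) (le_iSup₂ k k)
      simp only [hT, hG, hG', hef.mul_pow, hef'.symm.mul_pow]
      rfl
  set K := FF se sf with hK
  have hTK (k : ℕ) : T k ≤ K := hFT ▸ (le_iSup T k).trans (Submodule.le_topologicalClosure _)
  have hKK : K * K ≤ K := by
    rw [hFT]
    refine (Submodule.topologicalClosure_mul_le _ _).trans (Submodule.topologicalClosure_mono ?_)
    rw [Submodule.iSup_mul]
    refine iSup_le fun j => ?_
    rw [Submodule.mul_iSup]
    refine iSup_le fun k => le_trans ?_ (le_iSup T (max j k))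
    exact (mul_le_mul' (hTmono (le_max_left j k)) (hTmono (le_max_right j k))).trans
      (pow_mul_pow_mul_self_le hG'G _)
  have hGKG : G * K * G' ≤ K := by
    rw [hFT]
    calc G * (⨆ k, T k).topologicalClosure * G'
        ≤ G.topologicalClosure * (⨆ k, T k).topologicalClosure * G'.topologicalClosure := by
          gcongr <;> exact Submodule.le_topologicalClosure _
      _ ≤ (G * ⨆ k, T k).topologicalClosure * G'.topologicalClosure := by
          gcongr; exact Submodule.topologicalClosure_mul_le _ _
      _ ≤ (G * (⨆ k, T k) * G').topologicalClosure := Submodule.topologicalClosure_mul_le _ _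
      _ ≤ _ := by
          refine Submodule.topologicalClosure_mono ?_
          rw [Submodule.mul_iSup, Submodule.iSup_mul]
          refine iSup_le fun k => le_trans (le_of_eq ?_) (le_iSup T (k + 1))
          simp only [hT, pow_succ' G, pow_succ G', mul_assoc]
  have hlamg (i : Fin m) (j : Fin n) : lam (se i * sf j) = W * (se i * sf j) := by
    rw [map_mul, hle, hlf, hW, mul_assoc U (lamE se V), ← mul_assoc (lamE se V), lamE_mul he]
    simp only [mul_assoc]
  have hlamG : G.map lam.toAlgHom.toLinearMap ≤ K * G := by
    rw [hG, Submodule.span_mul_span, Submodule.map_span_le]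
    rintro _ ⟨_, ⟨i, rfl⟩, _, ⟨j, rfl⟩, rfl⟩
    change lam (se i * sf j) ∈ _
    rw [hlamg]
    exact Submodule.mul_mem_mul hWF
      (Submodule.subset_span (Set.mul_mem_mul ⟨i, rfl⟩ ⟨j, rfl⟩))
  have hlamG' : G'.map lam.toAlgHom.toLinearMap ≤ G' * K := by
    rw [hG', Submodule.span_mul_span, ← Set.star_mul, Submodule.map_span_le]
    intro x hx
    obtain ⟨_, ⟨i, rfl⟩, _, ⟨j, rfl⟩, h⟩ := hx
    obtain rfl : star (se i * sf j) = x := star_eq_iff_star_eq.2 h.symm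
    change lam (star (se i * sf j)) ∈ _
    rw [map_star, hlamg, star_mul W]
    exact Submodule.mul_mem_mul (Submodule.subset_span
      (Set.star_mem_star.2 (Set.mul_mem_mul ⟨i, rfl⟩ ⟨j, rfl⟩))) (star_mem_FF hWF)
  have hlamT (k : ℕ) : (T k).map lam.toAlgHom.toLinearMap ≤ K := by
    induction k with
    | zero =>
      refine le_trans (le_of_eq ?_) (hTK 0)
      simp only [hT, pow_zero, mul_one]
      exact Submodule.map_one _
    | succ k ih =>
      have hstep : T (k + 1) = G * T k * G' := by
        simp only [hT, pow_succ' G, pow_succ G', mul_assoc]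
      rw [hstep, Submodule.map_mul, Submodule.map_mul]
      calc _ ≤ K * G * K * (G' * K) := mul_le_mul' (mul_le_mul' hlamG ih) hlamG'
        _ = K * (G * K * G') * K := by simp only [mul_assoc]
        _ ≤ K * K * K := by gcongr
        _ ≤ K * K := by gcongr
        _ ≤ K := hKK
  intro x hx
  have hclosed : IsClosed (K : Set A) := Submodule.isClosed_topologicalClosure _
  have hcont : Continuous lam :=
    AddMonoidHomClass.continuous_of_bound lam 1 fun x => by
      simpa using NonUnitalStarAlgHom.norm_apply_le lam x
  rw [hFT] at hx
  refine hclosed.closure_subset (map_mem_closure hcont hx fun y hy => ?_)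
  exact (iSup_le fun k => Submodule.map_le_iff_le_comap.1 (hlamT k) :
    ⨆ k, T k ≤ K.comap lam.toAlgHom.toLinearMap) hy
end
end

section
/- Let ω be a state on A such that (a) ω(XY) = ω(YX) for all X, Y ∈ 𝔉, and (b) ω(s_{a,b} s_{a',b'}^*) = 0 whenever the degree of the word s_{a,b} differs from the degree of the word s_{a',b'}. Then for all words s_u := s_{a,b}, s_v := s_{a',b'}, s_{u'} := s_{c,d}, s_{v'} := s_{c',d'} one has ω((s_u s_v^*)(s_{u'} s_{v'}^*)) = m^p n^q · ω((s_{u'} s_{v'}^*)(s_u s_v^*)), where (p,q) ∈ ℤ² is the difference of the degrees of s_{u'} and s_{v'}. (Equivalently: with respect to the inner product ⟨A|B⟩ = ω(A^*B), the map F(s_u s_v^*) = m^{p'} n^{q'} s_v s_u^* with (p',q') the degree difference of s_u and s_v is adjoint to the Tomita operator S(A) = A^* on the span of the generators.) -/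
open scoped ComplexOrder

noncomputable section

variable {A : Type*} [CStarAlgebra A]

section Words

open scoped Pointwise

/-- `S` consists of isometries, and all quotients `x^* y` with `x, y ∈ S` are scalars. -/
structure StarMulScalar (S : Set A) : Prop where
  isometry : ∀ x ∈ S, star x * x = 1
  scalar : ∀ x ∈ S, ∀ y ∈ S, ∃ c : ℂ, star x * y = c • (1 : A)

/-- Some family of `N` elements of `S` has range projections summing to `1`. -/
def HasResolution (S : Set A) (N : ℕ) : Prop :=
  ∃ (ι : Type) (_ : Fintype ι) (g : ι → A),
    (∀ i, g i ∈ S) ∧ ∑ i, g i * star (g i) = 1 ∧ Fintype.card ι = N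

lemma StarMulScalar.one : StarMulScalar (1 : Set A) := by
  refine ⟨fun x hx => ?_, fun x hx y hy => ⟨1, ?_⟩⟩
  · simp [Set.mem_one.1 hx]
  · simp [Set.mem_one.1 hx, Set.mem_one.1 hy]

lemma StarMulScalar.mul {S T : Set A} (hS : StarMulScalar S) (hT : StarMulScalar T) :
    StarMulScalar (S * T) := by
  constructor
  · rintro _ ⟨x, hx, x', hx', rfl⟩
    calc star (x * x') * (x * x') = star x' * (star x * x) * x' := by
          simp only [star_mul, mul_assoc]
      _ = 1 := by rw [hS.isometry x hx, mul_one, hT.isometry x' hx']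
  rintro _ ⟨x, hx, x', hx', rfl⟩ _ ⟨y, hy, y', hy', rfl⟩
  obtain ⟨c, hc⟩ := hS.scalar x hx y hy
  obtain ⟨d, hd⟩ := hT.scalar x' hx' y' hy'
  refine ⟨c * d, ?_⟩
  calc star (x * x') * (y * y') = star x' * (star x * y) * y' := by
        simp only [star_mul, mul_assoc]
    _ = (c * d) • (1 : A) := by
        rw [hc, mul_smul_comm, mul_one, smul_mul_assoc, hd, smul_smul]

lemma StarMulScalar.pow {S : Set A} (hS : StarMulScalar S) (k : ℕ) : StarMulScalar (S ^ k) := by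
  induction k with
  | zero => simpa using StarMulScalar.one
  | succ k ih => rw [pow_succ]; exact ih.mul hS

lemma HasResolution.one : HasResolution (1 : Set A) 1 :=
  ⟨Unit, inferInstance, fun _ => 1, by simp⟩

lemma HasResolution.mul {S T : Set A} {N M : ℕ} (hS : HasResolution S N)
    (hT : HasResolution T M) : HasResolution (S * T) (N * M) := by
  obtain ⟨ι, _, g, hg, hg1, rfl⟩ := hS
  obtain ⟨κ, _, h, hh, hh1, rfl⟩ := hT
  refine ⟨ι × κ, inferInstance, fun p => g p.1 * h p.2,
    fun p => Set.mul_mem_mul (hg _) (hh _), ?_, Fintype.card_prod _ _⟩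
  rw [Fintype.sum_prod_type]
  calc ∑ i, ∑ j, g i * h j * star (g i * h j)
      = ∑ i, g i * (∑ j, h j * star (h j)) * star (g i) := by
        simp only [star_mul, mul_assoc, Finset.mul_sum, Finset.sum_mul]
    _ = 1 := by simp only [hh1, mul_one, hg1]

lemma HasResolution.pow {S : Set A} {N : ℕ} (hS : HasResolution S N) (k : ℕ) :
    HasResolution (S ^ k) (N ^ k) := by
  induction k with
  | zero => simpa using HasResolution.one
  | succ k ih => rw [pow_succ, pow_succ]; exact ih.mul hS

lemma starMulScalar_range {ι : Type*} [DecidableEq ι] {s : ι → A}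
    (hs : ∀ i k, star (s i) * s k = if i = k then (1 : A) else 0) :
    StarMulScalar (Set.range s) := by
  refine ⟨by rintro _ ⟨i, rfl⟩; simp [hs], ?_⟩
  rintro _ ⟨i, rfl⟩ _ ⟨k, rfl⟩
  exact ⟨if i = k then 1 else 0, by rw [hs]; split_ifs <;> simp⟩

lemma hasResolution_range {m : ℕ} {s : Fin m → A} (hs : ∑ i, s i * star (s i) = 1) :
    HasResolution (Set.range s) m :=
  ⟨Fin m, inferInstance, s, fun i => ⟨i, rfl⟩, hs, Fintype.card_fin m⟩

/-- The set of words of degree `(k, l)`. -/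
def wordSet {m n : ℕ} (se : Fin m → A) (sf : Fin n → A) (k l : ℕ) : Set A :=
  Set.range se ^ k * Set.range sf ^ l

lemma mem_range_pow_iff {m : ℕ} {s : Fin m → A} {k : ℕ} {x : A} :
    x ∈ Set.range s ^ k ↔ ∃ a : Fin k → Fin m, (List.ofFn fun t => s (a t)).prod = x := by
  rw [Set.mem_pow]
  constructor
  · rintro ⟨f, rfl⟩
    choose a ha using fun t => (f t).2
    exact ⟨a, by simp only [ha]⟩
  · rintro ⟨a, rfl⟩
    exact ⟨fun t => ⟨s (a t), a t, rfl⟩, rfl⟩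

lemma mem_wordSet_iff {m n : ℕ} {se : Fin m → A} {sf : Fin n → A} {k l : ℕ} {x : A} :
    x ∈ wordSet se sf k l ↔
      ∃ (a : Fin k → Fin m) (b : Fin l → Fin n), sWord se sf a b = x := by
  simp only [wordSet, Set.mem_mul, mem_range_pow_iff, sWord]
  constructor
  · rintro ⟨_, ⟨a, rfl⟩, _, ⟨b, rfl⟩, rfl⟩
    exact ⟨a, b, rfl⟩
  · rintro ⟨a, b, rfl⟩
    exact ⟨_, ⟨a, rfl⟩, _, ⟨b, rfl⟩, rfl⟩

lemma commute_range {m n : ℕ} {se : Fin m → A} {sf : Fin n → A}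
    {θ : Equiv.Perm (Fin m × Fin n)}
    (hcomm : ∀ i j, se i * sf j = sf (θ (i, j)).2 * se (θ (i, j)).1) :
    Commute (Set.range se) (Set.range sf) := by
  apply Set.Subset.antisymm
  · rintro _ ⟨_, ⟨i, rfl⟩, _, ⟨j, rfl⟩, rfl⟩
    exact ⟨_, ⟨_, rfl⟩, _, ⟨_, rfl⟩, (hcomm i j).symm⟩
  · rintro _ ⟨_, ⟨j, rfl⟩, _, ⟨i, rfl⟩, rfl⟩
    refine ⟨_, ⟨(θ.symm (i, j)).1, rfl⟩, _, ⟨(θ.symm (i, j)).2, rfl⟩, ?_⟩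
    simp [hcomm]

lemma mul_mem_wordSet {m n : ℕ} {se : Fin m → A} {sf : Fin n → A}
    (hc : Commute (Set.range se) (Set.range sf)) {k l k' l' K L : ℕ} {x y : A}
    (hx : x ∈ wordSet se sf k l) (hy : y ∈ wordSet se sf k' l')
    (hK : k + k' = K) (hL : l + l' = L) : x * y ∈ wordSet se sf K L := by
  subst hK hL
  have h : wordSet se sf k l * wordSet se sf k' l' = wordSet se sf (k + k') (l + l') := by
    simp only [wordSet, pow_add]
    exact (hc.symm.pow_pow l k').mul_mul_mul_comm _ _
  exact h ▸ Set.mul_mem_mul hx hy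

variable {S T : Set A} {ω : A →ₗ[ℂ] ℂ}

lemma StarMulScalar.star_mul_eq (hS : StarMulScalar S) (hone : ω 1 = 1) {x y : A}
    (hx : x ∈ S) (hy : y ∈ S) : star x * y = ω (star x * y) • (1 : A) := by
  obtain ⟨c, hc⟩ := hS.scalar x hx y hy
  simp [hc, hone]

/-- A functional tracial on the products `x y^*` with `x, y ∈ S` is the normalised trace there. -/
lemma card_mul_apply_mul_star {N : ℕ} (hS : StarMulScalar S) (hN : HasResolution S N)
    (hone : ω 1 = 1)
    (htr : ∀ x ∈ S, ∀ y ∈ S, ∀ z ∈ S, ∀ w ∈ S,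
      ω (x * star y * (z * star w)) = ω (z * star w * (x * star y)))
    {x y : A} (hx : x ∈ S) (hy : y ∈ S) :
    (N : ℂ) * ω (x * star y) = ω (star y * x) := by
  obtain ⟨ι, _, g, hg, hg1, rfl⟩ := hN
  have key (i : ι) : ω (x * star y) = ω (star y * x) * ω (g i * star (g i)) := by
    calc ω (x * star y) = ω (x * star (g i) * (g i * star y)) := by
          rw [mul_assoc, ← mul_assoc (star (g i)), hS.isometry _ (hg i), one_mul]
      _ = ω (g i * (star y * x) * star (g i)) := by
          rw [htr x hx _ (hg i) _ (hg i) y hy]; simp only [mul_assoc]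
      _ = _ := by
          rw [hS.star_mul_eq hone hy hx]
          simp [hone]
  calc (Fintype.card ι : ℂ) * ω (x * star y) = ∑ _i : ι, ω (x * star y) := by simp
    _ = ∑ i, ω (star y * x) * ω (g i * star (g i)) := Finset.sum_congr rfl fun i _ => key i
    _ = ω (star y * x) := by rw [← Finset.mul_sum, ← map_sum, hg1, hone, mul_one]

/-- Two resolutions of the identity inserted on either side of the middle product. -/
lemma apply_mul_star_mul_mul_star {ι κ : Type*} [Fintype ι] [Fintype κ] {g : ι → A} {h : κ → A}
    (hg : ∑ i, g i * star (g i) = 1) (hh : ∑ j, h j * star (h j) = 1)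
    (hS : StarMulScalar S) (hone : ω 1 = 1) {v u' : A}
    (hv : ∀ i, v * g i ∈ S) (hu' : ∀ j, u' * h j ∈ S) (u v' : A) :
    ω (u * star v * (u' * star v')) =
      ∑ i, ∑ j, ω (star (v * g i) * (u' * h j)) * ω (u * g i * star (v' * h j)) := by
  calc ω (u * star v * (u' * star v'))
      = ω (u * (∑ i, g i * star (g i)) * star v *
          (u' * (∑ j, h j * star (h j)) * star v')) := by rw [hg, hh, mul_one, mul_one]
    _ = ∑ i, ∑ j, ω (u * g i * (star (v * g i) * (u' * h j)) * star (v' * h j)) := by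
        simp only [← map_sum]
        simp only [star_mul, Finset.mul_sum, Finset.sum_mul, mul_assoc]
        rw [Finset.sum_comm]
    _ = _ := by
        refine Finset.sum_congr rfl fun i _ => Finset.sum_congr rfl fun j _ => ?_
        rw [hS.star_mul_eq hone (hv i) (hu' j)]
        simp [hone]

end Words

/-- computational content of Lemma 5.2 / Proposition 5.4(ii): for a state
`ω` that is tracial on `𝔉` and kills generators of nonzero total degree, on generators
`X = s_u s_v^*`, `Y = s_{u'} s_{v'}^*` one has `ω(XY) = m^p n^q ω(YX)`, where `(p, q)`
is the difference of the degrees of `s_{u'}` and `s_{v'}`. -/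
theorem stmt17 {m n : ℕ} (hm : 1 ≤ m) (hn : 1 ≤ n) (θ : Equiv.Perm (Fin m × Fin n))
    (se : Fin m → A) (sf : Fin n → A)
    (he : ∀ i k, star (se i) * se k = if i = k then (1:A) else 0)
    (hf : ∀ j l, star (sf j) * sf l = if j = l then (1:A) else 0)
    (hcomm : ∀ i j, se i * sf j = sf (θ (i, j)).2 * se (θ (i, j)).1)
    (hde : ∑ i, se i * star (se i) = 1)
    (hdf : ∑ j, sf j * star (sf j) = 1)
    (ω : A →ₗ[ℂ] ℂ) (hpos : ∀ a : A, 0 ≤ ω (star a * a)) (hone : ω 1 = 1)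
    (htrace : ∀ X ∈ FF se sf, ∀ Y ∈ FF se sf, ω (X * Y) = ω (Y * X))
    (hgauge : ∀ (k l k' l' : ℕ) (a : Fin k → Fin m) (b : Fin l → Fin n)
      (a' : Fin k' → Fin m) (b' : Fin l' → Fin n), (k, l) ≠ (k', l') →
      ω (sWord se sf a b * star (sWord se sf a' b')) = 0) :
    ∀ (k₁ l₁ k₂ l₂ k₃ l₃ k₄ l₄ : ℕ)
      (a₁ : Fin k₁ → Fin m) (b₁ : Fin l₁ → Fin n)
      (a₂ : Fin k₂ → Fin m) (b₂ : Fin l₂ → Fin n)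
      (a₃ : Fin k₃ → Fin m) (b₃ : Fin l₃ → Fin n)
      (a₄ : Fin k₄ → Fin m) (b₄ : Fin l₄ → Fin n),
      ω ((sWord se sf a₁ b₁ * star (sWord se sf a₂ b₂)) *
          (sWord se sf a₃ b₃ * star (sWord se sf a₄ b₄))) =
        (m : ℂ) ^ ((k₃ : ℤ) - (k₄ : ℤ)) * (n : ℂ) ^ ((l₃ : ℤ) - (l₄ : ℤ)) *
          ω ((sWord se sf a₃ b₃ * star (sWord se sf a₄ b₄)) *
            (sWord se sf a₁ b₁ * star (sWord se sf a₂ b₂))) := by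
  have hc := commute_range hcomm
  have hscal (k l : ℕ) : StarMulScalar (wordSet se sf k l) :=
    ((starMulScalar_range he).pow k).mul ((starMulScalar_range hf).pow l)
  have hres (k l : ℕ) : HasResolution (wordSet se sf k l) (m ^ k * n ^ l) :=
    ((hasResolution_range hde).pow k).mul ((hasResolution_range hdf).pow l)
  have hgauge' {k l k' l' : ℕ} {x y : A} (hx : x ∈ wordSet se sf k l)
      (hy : y ∈ wordSet se sf k' l') (hne : (k, l) ≠ (k', l')) : ω (x * star y) = 0 := by
    obtain ⟨a, b, rfl⟩ := mem_wordSet_iff.1 hx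
    obtain ⟨a', b', rfl⟩ := mem_wordSet_iff.1 hy
    exact hgauge _ _ _ _ a b a' b' hne
  have hFF {k l : ℕ} {x y : A} (hx : x ∈ wordSet se sf k l) (hy : y ∈ wordSet se sf k l) :
      x * star y ∈ FF se sf := by
    obtain ⟨a, b, rfl⟩ := mem_wordSet_iff.1 hx
    obtain ⟨a', b', rfl⟩ := mem_wordSet_iff.1 hy
    exact Submodule.le_topologicalClosure _ (Submodule.subset_span ⟨k, l, a, a', b, b', rfl⟩)
  have htr {k l : ℕ} {x y : A} (hx : x ∈ wordSet se sf k l) (hy : y ∈ wordSet se sf k l) :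
      (m : ℂ) ^ k * (n : ℂ) ^ l * ω (x * star y) = ω (star y * x) := by
    have := card_mul_apply_mul_star (hscal k l) (hres k l) hone
      (fun x hx y hy z hz w hw => htrace _ (hFF hx hy) _ (hFF hz hw)) hx hy
    exact_mod_cast this
  have hword {k l : ℕ} (a : Fin k → Fin m) (b : Fin l → Fin n) :
      sWord se sf a b ∈ wordSet se sf k l := mem_wordSet_iff.2 ⟨a, b, rfl⟩
  intro k₁ l₁ k₂ l₂ k₃ l₃ k₄ l₄ a₁ b₁ a₂ b₂ a₃ b₃ a₄ b₄
  have h₁ := hword a₁ b₁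
  have h₂ := hword a₂ b₂
  have h₃ := hword a₃ b₃
  have h₄ := hword a₄ b₄
  set u := sWord se sf a₁ b₁
  set v := sWord se sf a₂ b₂
  set u' := sWord se sf a₃ b₃
  set v' := sWord se sf a₄ b₄
  obtain ⟨ι, _, g, hg, hg1, -⟩ := hres k₃ l₃
  obtain ⟨κ, _, h, hh, hh1, -⟩ := hres k₂ l₂
  have hvg (i : ι) : v * g i ∈ wordSet se sf (k₂ + k₃) (l₂ + l₃) :=
    mul_mem_wordSet hc h₂ (hg i) rfl rfl
  have huh (j : κ) : u' * h j ∈ wordSet se sf (k₂ + k₃) (l₂ + l₃) :=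
    mul_mem_wordSet hc h₃ (hh j) (add_comm _ _) (add_comm _ _)
  have hug (i : ι) : u * g i ∈ wordSet se sf (k₁ + k₃) (l₁ + l₃) :=
    mul_mem_wordSet hc h₁ (hg i) rfl rfl
  have hvh (j : κ) : v' * h j ∈ wordSet se sf (k₂ + k₄) (l₂ + l₄) :=
    mul_mem_wordSet hc h₄ (hh j) (add_comm _ _) (add_comm _ _)
  have hL := apply_mul_star_mul_mul_star hg1 hh1 (hscal _ _) hone hvg huh u v'
  by_cases hdeg : k₁ + k₃ = k₂ + k₄ ∧ l₁ + l₃ = l₂ + l₄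
  · obtain ⟨hk, hl⟩ := hdeg
    rw [← hk, ← hl] at hvh
    have hR := apply_mul_star_mul_mul_star hh1 hg1 (hscal _ _) hone hvh hug u' v
    have hm0 : (m : ℂ) ≠ 0 := by exact_mod_cast (by omega : m ≠ 0)
    have hn0 : (n : ℂ) ≠ 0 := by exact_mod_cast (by omega : n ≠ 0)
    have hLR : (m : ℂ) ^ (k₁ + k₃) * (n : ℂ) ^ (l₁ + l₃) * ω (u * star v * (u' * star v')) =
        (m : ℂ) ^ (k₂ + k₃) * (n : ℂ) ^ (l₂ + l₃) * ω (u' * star v' * (u * star v)) := by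
      rw [hL, hR, Finset.sum_comm]
      simp only [Finset.mul_sum]
      refine Finset.sum_congr rfl fun j _ => Finset.sum_congr rfl fun i _ => ?_
      rw [mul_left_comm, htr (hug i) (hvh j), mul_left_comm, htr (huh j) (hvg i), mul_comm]
    have hpow {z : ℂ} (hz : z ≠ 0) {a b c d : ℕ} (habcd : a + c = b + d) :
        z ^ (b + c) = z ^ (a + c) * z ^ ((c : ℤ) - (d : ℤ)) := by
      rw [← zpow_natCast, ← zpow_natCast, ← zpow_add₀ hz]
      congr 1
      omega
    rw [hpow hm0 hk, hpow hn0 hl] at hLR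
    refine mul_left_cancel₀ (mul_ne_zero (pow_ne_zero (k₁ + k₃) hm0)
      (pow_ne_zero (l₁ + l₃) hn0)) (hLR.trans ?_)
    ring
  · obtain ⟨ι', _, g', hg', hg1', -⟩ := hres k₁ l₁
    obtain ⟨κ', _, h', hh', hh1', -⟩ := hres k₄ l₄
    have hR := apply_mul_star_mul_mul_star (S := wordSet se sf (k₄ + k₁) (l₄ + l₁)) hg1' hh1'
      (hscal _ _) hone (fun i => mul_mem_wordSet hc h₄ (hg' i) rfl rfl)
      (fun j => mul_mem_wordSet hc h₁ (hh' j) (add_comm _ _) (add_comm _ _)) u' v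
    rw [hL, hR]
    have hzL (i : ι) (j : κ) : ω (u * g i * star (v' * h j)) = 0 :=
      hgauge' (hug i) (hvh j) fun he => hdeg (Prod.mk.inj he)
    have hzR (i : ι') (j : κ') : ω (u' * g' i * star (v * h' j)) = 0 :=
      hgauge' (mul_mem_wordSet hc h₃ (hg' i) rfl rfl) (mul_mem_wordSet hc h₂ (hh' j) rfl rfl)
        fun he => hdeg (by rw [Prod.mk.injEq] at he; omega)
    simp only [hzL, hzR, mul_zero, Finset.sum_const_zero]
end
end
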